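/- arXiv:1902.04305 — 3 statements merged into one kernel-verified Lean document; each statement's English description precedes it below -/
import Mathlib

section
/- (Roughness of exponential dichotomy; Proposition 3.2(1a).) Suppose x' = A(t)x, with A : [0,∞) → n×n real matrices continuous, has a fundamental matrix Φ admitting an exponential dichotomy with projection P and constants M > 0, α > 0. Then there exists δ₀ > 0, depending only on M and α, such that for every continuous B : [0,∞) → n×n real matrices with sup_{t≥0}‖B(t)‖ ≤ δ₀, every fundamental matrix Ψ of the perturbed system x' = (A(t) + B(t))x admits an exponential dichotomy, i.e., there exist a matrix P̃ with P̃² = P̃ and constants M̃ > 0, α̃ > 0 with ‖Ψ(t)P̃Ψ(s)⁻¹‖ ≤ M̃ e^{−α̃(t−s)} for 0 ≤ s ≤ t and ‖Ψ(t)(I−P̃)Ψ(s)⁻¹‖ ≤ M̃ e^{α̃(t−s)} for 0 ≤ t ≤ s. Consequently the exponential dichotomy spectrum Σ_ED(A) is stable under sufficiently small bounded perturbations. -/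
open Set Filter Topology

/-- `Φ` is a fundamental solution of `x' = A(t) x` on the half-line `t ≥ 0`, with pointwise
inverse `Φi`. -/
structure IsFundamentalPair {R : Type*} [NormedRing R] [NormedAlgebra ℝ R]
    (A Φ Φi : ℝ → R) : Prop where
  hasDerivAt : ∀ t, 0 ≤ t → HasDerivAt Φ (A t * Φ t) t
  mul_inv : ∀ t, 0 ≤ t → Φ t * Φi t = 1
  inv_mul : ∀ t, 0 ≤ t → Φi t * Φ t = 1

theorem integral_exp_neg_mul_abs_le {γ a b t : ℝ} (hγ : 0 < γ) (hab : a ≤ b)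
    (ht : b ≤ t ∨ t ≤ a) : ∫ u in a..b, Real.exp (-γ * |t - u|) ≤ 1 / γ := by
  have key (c : ℝ) (hc : c ≠ 0) : ∫ u in a..b, Real.exp (c * (u - t)) =
      Real.exp (c * (b - t)) / c - Real.exp (c * (a - t)) / c := by
    refine intervalIntegral.integral_eq_sub_of_hasDerivAt
      (f := fun u => Real.exp (c * (u - t)) / c) (fun u _ => ?_)
      (Continuous.intervalIntegrable (by fun_prop) _ _)
    have h := ((((hasDerivAt_id u).sub_const t).const_mul c).exp).div_const c
    simpa [hc] using h
  rcases ht with ht | ht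
  · have hcongr : ∫ u in a..b, Real.exp (-γ * |t - u|) = ∫ u in a..b, Real.exp (γ * (u - t)) := by
      refine intervalIntegral.integral_congr fun u hu => ?_
      rw [uIcc_of_le hab] at hu
      simp only [abs_of_nonneg (by linarith [hu.2] : (0 : ℝ) ≤ t - u)]
      congr 1
      ring
    rw [hcongr, key γ hγ.ne', ← sub_div]
    have : Real.exp (γ * (b - t)) ≤ 1 := Real.exp_le_one_iff.2 (by nlinarith)
    gcongr
    linarith [Real.exp_pos (γ * (a - t))]
  · have hcongr : ∫ u in a..b, Real.exp (-γ * |t - u|) =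
        ∫ u in a..b, Real.exp (-γ * (u - t)) := by
      refine intervalIntegral.integral_congr fun u hu => ?_
      rw [uIcc_of_le hab] at hu
      simp only [abs_of_nonpos (by linarith [hu.1] : t - u ≤ (0 : ℝ))]
      congr 1
      ring
    rw [hcongr, key (-γ) (neg_ne_zero.2 hγ.ne'), ← sub_div, div_neg, ← neg_div]
    have : Real.exp (-γ * (a - t)) ≤ 1 := Real.exp_le_one_iff.2 (by nlinarith)
    gcongr
    linarith [Real.exp_pos (-γ * (b - t))]

namespace IsFundamentalPair

variable {R : Type*} [NormedRing R] [NormedAlgebra ℝ R]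
  {A B Φ Φi Ψ Ψi : ℝ → R}

theorem continuousOn (hΦ : IsFundamentalPair A Φ Φi) : ContinuousOn Φ (Ici 0) :=
  fun t ht => (hΦ.hasDerivAt t ht).continuousAt.continuousWithinAt

variable [CompleteSpace R]

theorem hasDerivWithinAt_inv (hΦ : IsFundamentalPair A Φ Φi) {t : ℝ} (ht : 0 ≤ t) :
    HasDerivWithinAt Φi (-(Φi t * A t)) (Ici 0) t := by
  have hinv (u : ℝ) (hu : 0 ≤ u) : Φi u = Ring.inverse (Φ u) :=
    (Ring.inverse_unit ⟨Φ u, Φi u, hΦ.mul_inv u hu, hΦ.inv_mul u hu⟩).symm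
  have h := (hasFDerivAt_ringInverse (𝕜 := ℝ)
    (⟨Φ t, Φi t, hΦ.mul_inv t ht, hΦ.inv_mul t ht⟩ : Rˣ)).comp_hasDerivAt t (hΦ.hasDerivAt t ht)
  refine (h.hasDerivWithinAt.congr (fun u hu => hinv u hu) (hinv t ht)).congr_deriv ?_
  simp [mul_assoc, hΦ.mul_inv t ht]

/-- Variation of constants for `Φ⁻¹ Ψ`. -/
theorem hasDerivWithinAt_inv_mul (hΦ : IsFundamentalPair A Φ Φi)
    (hΨ : IsFundamentalPair (fun t => A t + B t) Ψ Ψi) {t : ℝ} (ht : 0 ≤ t) :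
    HasDerivWithinAt (fun u => Φi u * Ψ u) (Φi t * (B t * Ψ t)) (Ici 0) t := by
  refine ((hΦ.hasDerivWithinAt_inv ht).mul (hΨ.hasDerivAt t ht).hasDerivWithinAt).congr_deriv ?_
  noncomm_ring

theorem norm_mul_inv_mul_sub_le {α M δ N a b s t : ℝ} {Q Z : R} (hα : 0 < α) (hM : 0 ≤ M)
    (hδ : 0 ≤ δ) (hΦ : IsFundamentalPair A Φ Φi)
    (hΨ : IsFundamentalPair (fun t => A t + B t) Ψ Ψi) (hB : Continuous B)
    (hBδ : ∀ u, 0 ≤ u → ‖B u‖ ≤ δ) (ha : 0 ≤ a) (hab : a ≤ b) (ht : b ≤ t ∨ t ≤ a)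
    (hQ : ∀ u ∈ Icc a b, ‖Φ t * (Q * Φi u)‖ ≤ M * Real.exp (-α * |t - u|))
    (hZ : ∀ u ∈ Icc a b, ‖Ψ u * Z‖ ≤ N * Real.exp (-(α / 2) * |u - s|)) :
    ‖Φ t * Q * (Φi b * Ψ b - Φi a * Ψ a) * Z‖ ≤
      2 * M * δ * N / α * Real.exp (-(α / 2) * |t - s|) := by
  have hN : 0 ≤ N := by
    have h := (norm_nonneg _).trans (hZ a (left_mem_Icc.2 hab))
    exact nonneg_of_mul_nonneg_left h (Real.exp_pos _)
  have hsub : Icc a b ⊆ Ici 0 := fun u hu => ha.trans hu.1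
  have hΦic : ContinuousOn Φi (Icc a b) := fun u hu =>
    (hΦ.hasDerivWithinAt_inv (hsub hu)).continuousWithinAt.mono hsub
  have hΨc : ContinuousOn Ψ (Icc a b) := hΨ.continuousOn.mono hsub
  have hftc : ∫ u in a..b, Φ t * Q * (Φi u * (B u * Ψ u)) * Z =
      Φ t * Q * (Φi b * Ψ b) * Z - Φ t * Q * (Φi a * Ψ a) * Z := by
    refine intervalIntegral.integral_eq_sub_of_hasDerivAt_of_le hab
      (f := fun u => Φ t * Q * (Φi u * Ψ u) * Z) (by fun_prop) (fun u hu => ?_) ?_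
    · have hu0 : 0 < u := ha.trans_lt hu.1
      exact ((((hΦ.hasDerivWithinAt_inv_mul hΨ hu0.le).hasDerivAt
        (Ici_mem_nhds hu0)).const_mul (Φ t * Q)).mul_const Z)
    · refine ContinuousOn.intervalIntegrable ?_
      rw [uIcc_of_le hab]
      fun_prop
  rw [mul_sub, sub_mul, ← hftc]
  have hbound : ∀ u ∈ Ioc a b, ‖Φ t * Q * (Φi u * (B u * Ψ u)) * Z‖ ≤
      M * δ * N * Real.exp (-(α / 2) * |t - s|) * Real.exp (-(α / 2) * |t - u|) := by
    intro u hu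
    have hu' := Ioc_subset_Icc_self hu
    calc ‖Φ t * Q * (Φi u * (B u * Ψ u)) * Z‖
        = ‖Φ t * (Q * Φi u) * B u * (Ψ u * Z)‖ := by simp only [mul_assoc]
      _ ≤ ‖Φ t * (Q * Φi u)‖ * ‖B u‖ * ‖Ψ u * Z‖ :=
          (norm_mul_le _ _).trans (by gcongr; exact norm_mul_le _ _)
      _ ≤ (M * Real.exp (-α * |t - u|)) * δ * (N * Real.exp (-(α / 2) * |u - s|)) := by
          gcongr
          exacts [hQ u hu', hBδ u (hsub hu'), hZ u hu']
      _ = M * δ * N * Real.exp (-α * |t - u| + -(α / 2) * |u - s|) := by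
          rw [Real.exp_add]; ring
      _ ≤ M * δ * N * Real.exp (-(α / 2) * |t - s| + -(α / 2) * |t - u|) := by
          refine mul_le_mul_of_nonneg_left (Real.exp_le_exp.2 ?_) (by positivity)
          nlinarith [abs_sub_le t u s]
      _ = _ := by rw [Real.exp_add]; ring
  refine (intervalIntegral.norm_integral_le_of_norm_le hab (Eventually.of_forall hbound)
    (Continuous.intervalIntegrable (by fun_prop) _ _)).trans ?_
  rw [intervalIntegral.integral_const_mul]
  calc _ ≤ M * δ * N * Real.exp (-(α / 2) * |t - s|) * (1 / (α / 2)) := by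
        gcongr
        exact integral_exp_neg_mul_abs_le (by positivity) hab ht
    _ = _ := by field_simp

/-- A priori estimate for solutions `Ψ C` on `[s, T]`, `Ψ D` on `[0, s]` of the perturbed system
which jump by `v` at `s` and satisfy the stable boundary condition at `0` and the unstable one
at `T`. -/
theorem norm_mul_le_of_boundary {α M δ s T : ℝ} {P C D v : R} (hα : 0 < α) (hM : 0 < M)
    (hδ : 0 ≤ δ) (hδM : 12 * M * δ ≤ α) (hΦ : IsFundamentalPair A Φ Φi)
    (hΨ : IsFundamentalPair (fun t => A t + B t) Ψ Ψi) (hB : Continuous B)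
    (hBδ : ∀ u, 0 ≤ u → ‖B u‖ ≤ δ)
    (hs : ∀ u t, 0 ≤ u → u ≤ t → ‖Φ t * (P * Φi u)‖ ≤ M * Real.exp (-α * (t - u)))
    (hu : ∀ t u, 0 ≤ t → t ≤ u → ‖Φ t * ((1 - P) * Φi u)‖ ≤ M * Real.exp (α * (t - u)))
    (hs0 : 0 ≤ s) (hsT : s ≤ T) (hv : Ψ s * (C - D) = v)
    (hD : P * (Φi 0 * Ψ 0) * D = 0) (hC : (1 - P) * (Φi T * Ψ T) * C = 0) :
    (∀ t ∈ Icc s T, ‖Ψ t * C‖ ≤ 2 * M * ‖v‖ * Real.exp (-(α / 2) * |t - s|)) ∧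
    (∀ t ∈ Icc 0 s, ‖Ψ t * D‖ ≤ 2 * M * ‖v‖ * Real.exp (-(α / 2) * |t - s|)) := by
  have hs' (t u : ℝ) (h0 : 0 ≤ u) (hut : u ≤ t) :
      ‖Φ t * (P * Φi u)‖ ≤ M * Real.exp (-α * |t - u|) := by
    rw [abs_of_nonneg (sub_nonneg.2 hut)]; exact hs u t h0 hut
  have hu' (t u : ℝ) (h0 : 0 ≤ t) (htu : t ≤ u) :
      ‖Φ t * ((1 - P) * Φi u)‖ ≤ M * Real.exp (-α * |t - u|) := by
    rw [abs_of_nonpos (sub_nonpos.2 htu), neg_mul_neg]; exact hu t u h0 htu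
  have hweaken (t : ℝ) : M * Real.exp (-α * |t - s|) * ‖v‖ ≤
      M * ‖v‖ * Real.exp (-(α / 2) * |t - s|) := by
    rw [mul_right_comm]
    gcongr
    nlinarith [abs_nonneg (t - s)]
  have hjump : Φi s * Ψ s * C - Φi s * Ψ s * D = Φi s * v := by
    rw [← hv]; noncomm_ring
  have hΦΨ (t : ℝ) (ht : 0 ≤ t) : Φ t * (Φi t * Ψ t) = Ψ t := by
    rw [← mul_assoc, hΦ.mul_inv t ht, one_mul]
  have improve (N : ℝ)
      (hNC : ∀ t ∈ Icc s T, ‖Ψ t * C‖ ≤ N * Real.exp (-(α / 2) * |t - s|))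
      (hND : ∀ t ∈ Icc 0 s, ‖Ψ t * D‖ ≤ N * Real.exp (-(α / 2) * |t - s|)) :
      (∀ t ∈ Icc s T, ‖Ψ t * C‖ ≤ (M * ‖v‖ + N / 2) * Real.exp (-(α / 2) * |t - s|)) ∧
      (∀ t ∈ Icc 0 s, ‖Ψ t * D‖ ≤ (M * ‖v‖ + N / 2) * Real.exp (-(α / 2) * |t - s|)) := by
    have hN : 0 ≤ N :=
      nonneg_of_mul_nonneg_left ((norm_nonneg _).trans (hNC s ⟨le_rfl, hsT⟩)) (Real.exp_pos _)
    have hsum (t : ℝ) : 3 * (2 * M * δ * N / α * Real.exp (-(α / 2) * |t - s|)) ≤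
        N / 2 * Real.exp (-(α / 2) * |t - s|) := by
      rw [← mul_assoc]
      gcongr
      rw [mul_div_assoc', div_le_iff₀ hα]
      nlinarith
    refine ⟨fun t ht => ?_, fun t ht => ?_⟩
    · have ht0 : 0 ≤ t := hs0.trans ht.1
      have hdecomp : Ψ t * C = Φ t * P * (Φi t * Ψ t - Φi s * Ψ s) * C
          + Φ t * P * (Φi s * Ψ s - Φi 0 * Ψ 0) * D + Φ t * (P * Φi s) * v
          - Φ t * (1 - P) * (Φi T * Ψ T - Φi t * Ψ t) * C := by
        have h1 : Φ t * P * (Φi s * Ψ s * C - Φi s * Ψ s * D) = Φ t * (P * Φi s) * v := by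
          rw [hjump]; noncomm_ring
        have h2 : Φ t * P * (Φi 0 * Ψ 0) * D = 0 := by
          rw [mul_assoc (Φ t), mul_assoc (Φ t), hD, mul_zero]
        have h3 : Φ t * (1 - P) * (Φi T * Ψ T) * C = 0 := by
          rw [mul_assoc (Φ t), mul_assoc (Φ t), hC, mul_zero]
        conv_lhs => rw [← hΦΨ t ht0]
        rw [mul_sub _ (Φi s * Ψ s), sub_mul, h2, mul_sub _ (Φi T * Ψ T), sub_mul, h3, ← h1]
        noncomm_ring
      have e1 := hΦ.norm_mul_inv_mul_sub_le (t := t) (Q := P) hα hM.le hδ hΨ hB hBδ hs0 ht.1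
        (.inl le_rfl) (fun u hu => hs' t u (hs0.trans hu.1) hu.2)
        (fun u hu => hNC u ⟨hu.1, hu.2.trans ht.2⟩)
      have e2 := hΦ.norm_mul_inv_mul_sub_le (t := t) (Q := P) hα hM.le hδ hΨ hB hBδ le_rfl hs0
        (.inl ht.1) (fun u hu => hs' t u hu.1 (hu.2.trans ht.1)) hND
      have e3 := hΦ.norm_mul_inv_mul_sub_le (t := t) (Q := 1 - P) hα hM.le hδ hΨ hB hBδ ht0 ht.2
        (.inr le_rfl) (fun u hu => hu' t u ht0 hu.1)
        (fun u hu => hNC u ⟨ht.1.trans hu.1, hu.2⟩)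
      have e4 : ‖Φ t * (P * Φi s) * v‖ ≤ M * Real.exp (-α * |t - s|) * ‖v‖ :=
        (norm_mul_le _ _).trans (by gcongr; exact hs' t s hs0 ht.1)
      rw [hdecomp, add_mul]
      refine (norm_sub_le _ _).trans ?_
      refine (add_le_add_left (norm_add₃_le) _).trans ?_
      linarith [hsum t, hweaken t]
    · have hdecomp : Ψ t * D = Φ t * P * (Φi t * Ψ t - Φi 0 * Ψ 0) * D
          - Φ t * (1 - P) * (Φi s * Ψ s - Φi t * Ψ t) * D
          - Φ t * (1 - P) * (Φi T * Ψ T - Φi s * Ψ s) * C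
          - Φ t * ((1 - P) * Φi s) * v := by
        have h1 : Φ t * (1 - P) * (Φi s * Ψ s * C - Φi s * Ψ s * D) =
            Φ t * ((1 - P) * Φi s) * v := by
          rw [hjump]; simp only [mul_assoc]
        have h2 : Φ t * P * (Φi 0 * Ψ 0) * D = 0 := by
          rw [mul_assoc (Φ t), mul_assoc (Φ t), hD, mul_zero]
        have h3 : Φ t * (1 - P) * (Φi T * Ψ T) * C = 0 := by
          rw [mul_assoc (Φ t), mul_assoc (Φ t), hC, mul_zero]
        conv_lhs => rw [← hΦΨ t ht.1]
        rw [mul_sub _ (Φi t * Ψ t), sub_mul, h2, mul_sub _ (Φi T * Ψ T), sub_mul, h3, ← h1]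
        noncomm_ring
      have e1 := hΦ.norm_mul_inv_mul_sub_le (t := t) (Q := P) hα hM.le hδ hΨ hB hBδ le_rfl ht.1
        (.inl le_rfl) (fun u hu => hs' t u hu.1 hu.2)
        (fun u hu => hND u ⟨hu.1, hu.2.trans ht.2⟩)
      have e2 := hΦ.norm_mul_inv_mul_sub_le (t := t) (Q := 1 - P) hα hM.le hδ hΨ hB hBδ ht.1 ht.2
        (.inr le_rfl) (fun u hu => hu' t u ht.1 hu.1)
        (fun u hu => hND u ⟨ht.1.trans hu.1, hu.2⟩)
      have e3 := hΦ.norm_mul_inv_mul_sub_le (t := t) (Q := 1 - P) hα hM.le hδ hΨ hB hBδ hs0 hsT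
        (.inr ht.2) (fun u hu => hu' t u ht.1 (ht.2.trans hu.1)) hNC
      have e4 : ‖Φ t * ((1 - P) * Φi s) * v‖ ≤ M * Real.exp (-α * |t - s|) * ‖v‖ :=
        (norm_mul_le _ _).trans (by gcongr; exact hu' t s ht.1 ht.2)
      rw [hdecomp, add_mul]
      refine (norm_sub_le _ _).trans ?_
      refine (add_le_add_left ((norm_sub_le _ _).trans
        (add_le_add_left (norm_sub_le _ _) _)) _).trans ?_
      linarith [hsum t, hweaken t]
  have hexp (t x : ℝ) : Real.exp (α / 2 * |t - s|) * x * Real.exp (-(α / 2) * |t - s|) = x := by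
    rw [mul_right_comm, ← Real.exp_add]; simp
  have hcont (Z : R) (a b : ℝ) (ha : 0 ≤ a) :
      ContinuousOn (fun t => Real.exp (α / 2 * |t - s|) * ‖Ψ t * Z‖) (Icc a b) := by
    have : ContinuousOn Ψ (Icc a b) := hΨ.continuousOn.mono fun u hu => ha.trans hu.1
    fun_prop
  obtain ⟨p, hp, hpmax⟩ := isCompact_Icc.exists_isMaxOn ⟨s, le_rfl, hsT⟩ (hcont C s T hs0)
  obtain ⟨q, hq, hqmax⟩ := isCompact_Icc.exists_isMaxOn ⟨s, hs0, le_rfl⟩ (hcont D 0 s le_rfl)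
  set N := max (Real.exp (α / 2 * |p - s|) * ‖Ψ p * C‖) (Real.exp (α / 2 * |q - s|) * ‖Ψ q * D‖)
  have hNC : ∀ t ∈ Icc s T, ‖Ψ t * C‖ ≤ N * Real.exp (-(α / 2) * |t - s|) := fun t ht => by
    rw [← hexp t ‖Ψ t * C‖]
    gcongr
    exact (hpmax ht).trans (le_max_left _ _)
  have hND : ∀ t ∈ Icc 0 s, ‖Ψ t * D‖ ≤ N * Real.exp (-(α / 2) * |t - s|) := fun t ht => by
    rw [← hexp t ‖Ψ t * D‖]
    gcongr
    exact (hqmax ht).trans (le_max_right _ _)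
  obtain ⟨iC, iD⟩ := improve N hNC hND
  have hscale (t x y : ℝ) (h : x ≤ y * Real.exp (-(α / 2) * |t - s|)) :
      Real.exp (α / 2 * |t - s|) * x ≤ y := by
    rw [← hexp t y]
    calc _ ≤ Real.exp (α / 2 * |t - s|) * (y * Real.exp (-(α / 2) * |t - s|)) := by gcongr
      _ = _ := by ring
  have hle : N ≤ M * ‖v‖ + N / 2 :=
    max_le (hscale _ _ _ (iC p hp)) (hscale _ _ _ (iD q hq))
  have hle' : N ≤ 2 * M * ‖v‖ := by linarith
  exact ⟨fun t ht => (hNC t ht).trans (by gcongr), fun t ht => (hND t ht).trans (by gcongr)⟩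

end IsFundamentalPair

section FiniteDimensional

variable {E : Type*} [NormedAddCommGroup E] [NormedSpace ℝ E] [FiniteDimensional ℝ E]

theorem ContinuousLinearMap.isUnit_of_mul_eq_zero {S : E →L[ℝ] E}
    (hS : ∀ Z : E →L[ℝ] E, S * Z = 0 → Z = 0) : IsUnit S := by
  have hinj : Function.Injective S := by
    refine (injective_iff_map_eq_zero S).2 fun x hx => ?_
    by_contra hx0
    obtain ⟨f, hf⟩ := SeparatingDual.exists_eq_one (R := ℝ) hx0
    have hZ := hS (f.smulRight x) (by ext y; simp [hx])
    exact hx0 (by simpa [hf] using DFunLike.congr_fun hZ x)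
  have : CompleteSpace E := FiniteDimensional.complete ℝ E
  exact ContinuousLinearMap.isUnit_iff_bijective.2
    ⟨hinj, (LinearMap.injective_iff_surjective (f := (S : E →ₗ[ℝ] E))).1 hinj⟩

namespace IsFundamentalPair

variable {A B Φ Φi Ψ Ψi : ℝ → E →L[ℝ] E} {P : E →L[ℝ] E} {α M δ : ℝ}

theorem exists_projection_Icc {T : ℝ} (hα : 0 < α) (hM : 0 < M)
    (hδ : 0 ≤ δ) (hδM : 12 * M * δ ≤ α) (hΦ : IsFundamentalPair A Φ Φi)
    (hΨ : IsFundamentalPair (fun t => A t + B t) Ψ Ψi) (hB : Continuous B)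
    (hBδ : ∀ u, 0 ≤ u → ‖B u‖ ≤ δ) (hP : P * P = P)
    (hs : ∀ u t, 0 ≤ u → u ≤ t → ‖Φ t * (P * Φi u)‖ ≤ M * Real.exp (-α * (t - u)))
    (hu : ∀ t u, 0 ≤ t → t ≤ u → ‖Φ t * ((1 - P) * Φi u)‖ ≤ M * Real.exp (α * (t - u)))
    (hT : 0 ≤ T) :
    ∃ Q : E →L[ℝ] E, Q * Q = Q ∧ ∀ s ∈ Icc 0 T,
      (∀ t ∈ Icc s T, ‖Ψ t * (Q * Ψi s)‖ ≤ 2 * M * Real.exp (-(α / 2) * (t - s))) ∧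
      (∀ t ∈ Icc 0 s, ‖Ψ t * ((1 - Q) * Ψi s)‖ ≤ 2 * M * Real.exp (α / 2 * (t - s))) := by
  have : CompleteSpace E := FiniteDimensional.complete ℝ E
  have hPP : P * (1 - P) = 0 := by rw [mul_sub, mul_one, hP, sub_self]
  have hPP' : (1 - P) * P = 0 := by rw [sub_mul, one_mul, hP, sub_self]
  set K₀ := Φi 0 * Ψ 0
  set K₁ := Φi T * Ψ T
  have hunit : IsUnit (P * K₀ + (1 - P) * K₁) := by
    refine ContinuousLinearMap.isUnit_of_mul_eq_zero fun Z hZ => ?_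
    have h0 : P * K₀ * Z = 0 := by
      calc P * K₀ * Z = P * P * K₀ * Z + P * (1 - P) * K₁ * Z := by rw [hP, hPP]; simp
        _ = P * ((P * K₀ + (1 - P) * K₁) * Z) := by noncomm_ring
        _ = 0 := by rw [hZ, mul_zero]
    have h1 : (1 - P) * K₁ * Z = 0 := by
      calc (1 - P) * K₁ * Z = (P * K₀ + (1 - P) * K₁) * Z - P * K₀ * Z := by noncomm_ring
        _ = 0 := by rw [hZ, h0, sub_zero]
    have h := (hΦ.norm_mul_le_of_boundary hα hM hδ hδM hΨ hB hBδ hs hu le_rfl hT (v := 0)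
      (by rw [sub_self, mul_zero]) h0 h1).2 0 ⟨le_rfl, le_rfl⟩
    rw [norm_zero, mul_zero, zero_mul, norm_le_zero_iff] at h
    rw [← one_mul Z, ← hΨ.inv_mul 0 le_rfl, mul_assoc, h, mul_zero]
  obtain ⟨u, hU⟩ := hunit
  set L : E →L[ℝ] E := ↑u⁻¹
  have hSL : (P * K₀ + (1 - P) * K₁) * L = 1 := by rw [← hU]; exact u.mul_inv
  have hLS : L * (P * K₀ + (1 - P) * K₁) = 1 := by rw [← hU]; exact u.inv_mul
  have hPL : P * K₀ * L = P := by
    calc P * K₀ * L = P * P * K₀ * L + P * (1 - P) * K₁ * L := by rw [hP, hPP]; simp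
      _ = P * ((P * K₀ + (1 - P) * K₁) * L) := by noncomm_ring
      _ = P := by rw [hSL, mul_one]
  have hPL' : (1 - P) * K₁ * L = 1 - P := by
    calc (1 - P) * K₁ * L = (P * K₀ + (1 - P) * K₁) * L - P * K₀ * L := by noncomm_ring
      _ = 1 - P := by rw [hSL, hPL]
  have hQ' : 1 - L * (P * K₀) = L * ((1 - P) * K₁) := by
    rw [sub_eq_iff_eq_add', ← mul_add, hLS]
  have hD : P * K₀ * (1 - L * (P * K₀)) = 0 := by
    rw [hQ', ← mul_assoc, hPL, ← mul_assoc, hPP, zero_mul]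
  have hC : (1 - P) * K₁ * (L * (P * K₀)) = 0 := by
    rw [← mul_assoc, hPL', ← mul_assoc, hPP', zero_mul]
  refine ⟨L * (P * K₀), ?_, fun s hs1 => ?_⟩
  · calc L * (P * K₀) * (L * (P * K₀)) = L * (P * K₀ * L * P * K₀) := by simp only [mul_assoc]
      _ = L * (P * K₀) := by rw [hPL, hP]
  have h := hΦ.norm_mul_le_of_boundary (s := s) (T := T) (v := 1) (C := L * (P * K₀) * Ψi s)
    (D := -((1 - L * (P * K₀)) * Ψi s)) hα hM hδ hδM hΨ hB hBδ hs hu hs1.1 hs1.2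
    (by rw [sub_neg_eq_add, ← add_mul, add_sub_cancel, one_mul, hΨ.mul_inv s hs1.1])
    (by rw [mul_neg, ← mul_assoc, hD, zero_mul, neg_zero])
    (by rw [← mul_assoc, hC, zero_mul])
  have hone : 2 * M * ‖(1 : E →L[ℝ] E)‖ ≤ 2 * M :=
    mul_le_of_le_one_right (by positivity) ContinuousLinearMap.norm_id_le
  refine ⟨fun t ht => (h.1 t ht).trans ?_, fun t ht => ?_⟩
  · rw [abs_of_nonneg (sub_nonneg.2 ht.1)]
    gcongr
  · have := h.2 t ht
    rw [mul_neg, norm_neg, abs_of_nonpos (sub_nonpos.2 ht.2), neg_mul_neg] at this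
    exact this.trans (by gcongr)

theorem exists_projection (hα : 0 < α) (hM : 0 < M)
    (hδ : 0 ≤ δ) (hδM : 12 * M * δ ≤ α) (hΦ : IsFundamentalPair A Φ Φi)
    (hΨ : IsFundamentalPair (fun t => A t + B t) Ψ Ψi) (hB : Continuous B)
    (hBδ : ∀ u, 0 ≤ u → ‖B u‖ ≤ δ) (hP : P * P = P)
    (hs : ∀ u t, 0 ≤ u → u ≤ t → ‖Φ t * (P * Φi u)‖ ≤ M * Real.exp (-α * (t - u)))
    (hu : ∀ t u, 0 ≤ t → t ≤ u → ‖Φ t * ((1 - P) * Φi u)‖ ≤ M * Real.exp (α * (t - u))) :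
    ∃ Q : E →L[ℝ] E, Q * Q = Q ∧
      (∀ s t, 0 ≤ s → s ≤ t →
        ‖Ψ t * (Q * Ψi s)‖ ≤ 2 * M * Real.exp (-(α / 2) * (t - s))) ∧
      (∀ t s, 0 ≤ t → t ≤ s →
        ‖Ψ t * ((1 - Q) * Ψi s)‖ ≤ 2 * M * Real.exp (α / 2 * (t - s))) := by
  choose Q hQ hbound using fun k : ℕ =>
    hΦ.exists_projection_Icc hα hM hδ hδM hΨ hB hBδ hP hs hu (Nat.cast_nonneg (α := ℝ) k)
  have hQle (k : ℕ) : Q k ∈ Metric.closedBall 0 (‖Ψi 0‖ * (2 * M) * ‖Ψ 0‖) := by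
    have h0 := (hbound k 0 ⟨le_rfl, k.cast_nonneg⟩).1 0 ⟨le_rfl, k.cast_nonneg⟩
    rw [sub_self, mul_zero, Real.exp_zero, mul_one] at h0
    rw [mem_closedBall_zero_iff]
    calc ‖Q k‖ = ‖Ψi 0 * Ψ 0 * Q k * (Ψi 0 * Ψ 0)‖ := by
          rw [hΨ.inv_mul 0 le_rfl, one_mul, mul_one]
      _ = ‖Ψi 0 * (Ψ 0 * (Q k * Ψi 0)) * Ψ 0‖ := by simp only [mul_assoc]
      _ ≤ ‖Ψi 0‖ * ‖Ψ 0 * (Q k * Ψi 0)‖ * ‖Ψ 0‖ :=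
          (norm_mul_le _ _).trans (by gcongr; exact norm_mul_le _ _)
      _ ≤ _ := by gcongr
  have : ProperSpace (E →L[ℝ] E) := FiniteDimensional.proper ℝ _
  obtain ⟨Q', -, φ, hφ, hlim⟩ := tendsto_subseq_of_bounded Metric.isBounded_closedBall hQle
  have hev (s : ℝ) : ∀ᶠ k in atTop, s ≤ (φ k : ℝ) :=
    (tendsto_natCast_atTop_atTop.comp hφ.tendsto_atTop).eventually_ge_atTop s
  refine ⟨Q', ?_, fun s t h0 hst => ?_, fun t s h0 hts => ?_⟩
  · refine tendsto_nhds_unique (hlim.mul hlim) (hlim.congr fun k => ?_)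
    exact (hQ (φ k)).symm
  · refine le_of_tendsto ((hlim.mul_const (Ψi s)).const_mul (Ψ t)).norm ?_
    filter_upwards [hev t] with k hk
    exact (hbound (φ k) s ⟨h0, hst.trans hk⟩).1 t ⟨hst, hk⟩
  · refine le_of_tendsto (((hlim.const_sub 1).mul_const (Ψi s)).const_mul (Ψ t)).norm ?_
    filter_upwards [hev s] with k hk
    exact (hbound (φ k) s ⟨h0.trans hts, hk⟩).2 t ⟨h0, hts⟩

end IsFundamentalPair

end FiniteDimensional


/-- roughness of exponential dichotomy; Proposition 3.2(1a). For all
constants `M > 0`, `α > 0` there exists `δ₀ > 0`, depending only on `M` and `α`, such that: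
whenever `x' = A(t) x` (with `A` continuous) has a fundamental matrix `Φ` admitting an
exponential dichotomy with projection `P` and constants `M, α`, and `B` is continuous with
`sup_{t ≥ 0} ‖B(t)‖ ≤ δ₀`, every fundamental matrix `Ψ` of the perturbed system
`x' = (A(t) + B(t)) x` admits an exponential dichotomy. -/
theorem exponential_dichotomy_roughness
    (M α : ℝ) (hM : 0 < M) (hα : 0 < α) :
    ∃ δ₀ > (0 : ℝ), ∀ (n : ℕ)
      (A Φ Φinv : ℝ → EuclideanSpace ℝ (Fin n) →L[ℝ] EuclideanSpace ℝ (Fin n)),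
      Continuous A →
      (∀ t : ℝ, 0 ≤ t → HasDerivAt Φ (A t ∘L Φ t) t) →
      (∀ t : ℝ, 0 ≤ t → Φ t ∘L Φinv t = 1 ∧ Φinv t ∘L Φ t = 1) →
      ∀ P : EuclideanSpace ℝ (Fin n) →L[ℝ] EuclideanSpace ℝ (Fin n), P ∘L P = P →
      (∀ s t : ℝ, 0 ≤ s → s ≤ t →
        ‖Φ t ∘L P ∘L Φinv s‖ ≤ M * Real.exp (-α * (t - s))) →
      (∀ t s : ℝ, 0 ≤ t → t ≤ s →
        ‖Φ t ∘L (1 - P) ∘L Φinv s‖ ≤ M * Real.exp (α * (t - s))) →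
      ∀ B : ℝ → EuclideanSpace ℝ (Fin n) →L[ℝ] EuclideanSpace ℝ (Fin n),
        Continuous B → (∀ t : ℝ, 0 ≤ t → ‖B t‖ ≤ δ₀) →
      ∀ Ψ Ψinv : ℝ → EuclideanSpace ℝ (Fin n) →L[ℝ] EuclideanSpace ℝ (Fin n),
        (∀ t : ℝ, 0 ≤ t → HasDerivAt Ψ ((A t + B t) ∘L Ψ t) t) →
        (∀ t : ℝ, 0 ≤ t → Ψ t ∘L Ψinv t = 1 ∧ Ψinv t ∘L Ψ t = 1) →
      ∃ Ptilde : EuclideanSpace ℝ (Fin n) →L[ℝ] EuclideanSpace ℝ (Fin n),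
        Ptilde ∘L Ptilde = Ptilde ∧ ∃ Mtilde > (0 : ℝ), ∃ αtilde > (0 : ℝ),
          (∀ s t : ℝ, 0 ≤ s → s ≤ t →
            ‖Ψ t ∘L Ptilde ∘L Ψinv s‖ ≤ Mtilde * Real.exp (-αtilde * (t - s))) ∧
          (∀ t s : ℝ, 0 ≤ t → t ≤ s →
            ‖Ψ t ∘L (1 - Ptilde) ∘L Ψinv s‖ ≤ Mtilde * Real.exp (αtilde * (t - s))) := by
  refine ⟨α / (12 * M), by positivity, fun n A Φ Φinv _ hΦ hΦi P hP hs hu B hB hBδ Ψ Ψinv hΨ hΨi =>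
    ?_⟩
  obtain ⟨Q, hQ, hQs, hQu⟩ := IsFundamentalPair.exists_projection hα hM (by positivity)
    (by field_simp; rfl) ⟨hΦ, fun t ht => (hΦi t ht).1, fun t ht => (hΦi t ht).2⟩
    ⟨hΨ, fun t ht => (hΨi t ht).1, fun t ht => (hΨi t ht).2⟩ hB hBδ hP hs hu
  exact ⟨Q, hQ, 2 * M, by positivity, α / 2, by positivity, hQs, hQu⟩
end

section
/- (Roughness of nonuniform exponential dichotomy; Proposition 3.2(2a).) Suppose x' = A(t)x, with A : [0,∞) → n×n real matrices continuous, has a fundamental matrix Φ admitting a nonuniform exponential dichotomy with projection P and constants M > 0, α > 0, ε ∈ [0, α). Then there exists δ₀ > 0, depending only on M, α and ε, such that for every δ ∈ (0, δ₀] and every continuous B : [0,∞) → n×n real matrices with ‖B(t)‖ ≤ δ e^{−εt} for all t ≥ 0, every fundamental matrix Ψ of the perturbed system x' = (A(t) + B(t))x admits a nonuniform exponential dichotomy, i.e., there exist a matrix P̃ with P̃² = P̃ and constants M̃ > 0, α̃ > 0, ε̃ ∈ [0, α̃) with ‖Ψ(t)P̃Ψ(s)⁻¹‖ ≤ M̃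 e^{−α̃(t−s)} e^{ε̃s} for 0 ≤ s ≤ t and ‖Ψ(t)(I−P̃)Ψ(s)⁻¹‖ ≤ M̃ e^{α̃(t−s)} e^{ε̃s} for 0 ≤ t ≤ s. -/
open Set Filter Topology

section NormedRing

variable {R : Type*} [NormedRing R] [NormedAlgebra ℝ R]

/-- If `Φ' = A Φ` on `[0, ∞)`, then the inverse satisfies `(Φ⁻¹)' = -Φ⁻¹ A`. -/
theorem hasDerivWithinAt_fundamental_inv [CompleteSpace R] {A Φ Φinv : ℝ → R}
    (hΦ : ∀ t : ℝ, 0 ≤ t → HasDerivAt Φ (A t * Φ t) t)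
    (hinv : ∀ t : ℝ, 0 ≤ t → Φ t * Φinv t = 1 ∧ Φinv t * Φ t = 1) {t : ℝ} (ht : 0 ≤ t) :
    HasDerivWithinAt Φinv (-(Φinv t * A t)) (Ici 0) t := by
  have hval : ∀ s : ℝ, 0 ≤ s → Φinv s = Ring.inverse (Φ s) := fun s hs =>
    (Ring.inverse_unit (⟨Φ s, Φinv s, (hinv s hs).1, (hinv s hs).2⟩ : Rˣ)).symm
  let u : Rˣ := ⟨Φ t, Φinv t, (hinv t ht).1, (hinv t ht).2⟩
  have h := ((hasFDerivAt_ringInverse (𝕜 := ℝ) u).comp_hasDerivAt t (hΦ t ht)).hasDerivWithinAt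
    (s := Ici 0)
  refine (h.congr (fun s hs => hval s hs) (hval t ht)).congr_deriv ?_
  simp [u, mul_assoc, (hinv t ht).1]

/-- Variation of constants in differential form. -/
theorem hasDerivWithinAt_transition [CompleteSpace R] {A B Φ Φinv Ψ : ℝ → R}
    (hΦ : ∀ t : ℝ, 0 ≤ t → HasDerivAt Φ (A t * Φ t) t)
    (hinv : ∀ t : ℝ, 0 ≤ t → Φ t * Φinv t = 1 ∧ Φinv t * Φ t = 1)
    (hΨ : ∀ t : ℝ, 0 ≤ t → HasDerivAt Ψ ((A t + B t) * Ψ t) t) (c d a : R)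
    {t : ℝ} (ht : 0 ≤ t) :
    HasDerivWithinAt (fun τ => c * (d * (Φinv τ * (Ψ τ * a))))
      (c * (d * (Φinv t * B t)) * (Ψ t * a)) (Ici 0) t := by
  have h := (((hasDerivWithinAt_fundamental_inv hΦ hinv ht).mul
    ((hΨ t ht).hasDerivWithinAt.mul_const a)).const_mul d).const_mul c
  refine h.congr_deriv ?_
  noncomm_ring

theorem norm_sub_le_of_norm_deriv_le_exp {f f' : ℝ → R} {c r η p q : ℝ} (hp : 0 ≤ p)
    (hpq : p ≤ q) (hr : r ≠ 0)
    (hf : ∀ τ, 0 ≤ τ → HasDerivWithinAt f (f' τ) (Ici 0) τ)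
    (hbound : ∀ τ, p ≤ τ → τ ≤ q → ‖f' τ‖ ≤ c * Real.exp (r * τ + η)) :
    ‖f q - f p‖ ≤ c / r * (Real.exp (r * q + η) - Real.exp (r * p + η)) := by
  have hF : ∀ τ : ℝ, HasDerivAt
      (fun τ => c / r * (Real.exp (r * τ + η) - Real.exp (r * p + η)))
      (c * Real.exp (r * τ + η)) τ := by
    intro τ
    have h := (((((hasDerivAt_id τ).const_mul r).add_const η).exp.sub_const
      (Real.exp (r * p + η))).const_mul (c / r))
    refine h.congr_deriv ?_
    simp only [id]
    field_simp
  have hg : ∀ τ, 0 ≤ τ → HasDerivWithinAt (fun τ => f τ - f p) (f' τ) (Ici 0) τ :=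
    fun τ hτ => (hf τ hτ).sub_const _
  refine image_norm_le_of_norm_deriv_right_le_deriv_boundary (f := fun τ => f τ - f p)
    (a := p) (b := q) (f' := f') ?_ ?_ ?_ hF ?_ ⟨hpq, le_rfl⟩
  · intro τ hτ
    exact ((hg τ (hp.trans hτ.1)).continuousWithinAt).mono (fun x hx => hp.trans hx.1)
  · intro τ hτ
    exact (hg τ (hp.trans hτ.1)).mono (fun x hx => (hp.trans hτ.1).trans hx)
  · simp
  · intro τ hτ
    exact hbound τ hτ.1 hτ.2.le

section Green

variable {B Φ Φinv Ψ : ℝ → R} {P Q : R} {α k ρ : ℝ}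

theorem norm_stable_sub_le (hρ : 0 < ρ) (hk0 : 0 ≤ k) (hkρ : 6 * k ≤ ρ)
    (hD : ∀ c d a : R, ∀ t : ℝ, 0 ≤ t →
      HasDerivWithinAt (fun τ => c * (d * (Φinv τ * (Ψ τ * a))))
        (c * (d * (Φinv t * B t)) * (Ψ t * a)) (Ici 0) t)
    (hP : ∀ s t : ℝ, 0 ≤ s → s ≤ t →
      ‖Φ t * (P * (Φinv s * B s))‖ ≤ k * Real.exp (-α * (t - s)))
    {a : R} {N γ η p q t : ℝ} (hN : 0 ≤ N) (hγ : ρ ≤ α + γ) (hp : 0 ≤ p) (hpq : p ≤ q)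
    (hqt : q ≤ t)
    (hu : ∀ τ, p ≤ τ → τ ≤ q → ‖Ψ τ * a‖ ≤ N * Real.exp (γ * τ + η)) :
    ‖Φ t * (P * (Φinv q * (Ψ q * a))) - Φ t * (P * (Φinv p * (Ψ p * a)))‖ ≤
      N / 6 * Real.exp (-α * (t - q) + γ * q + η) := by
  have hpos : 0 < α + γ := hρ.trans_le hγ
  have h := norm_sub_le_of_norm_deriv_le_exp (c := k * N) (r := α + γ) (η := η - α * t) hp hpq
    hpos.ne' (hD (Φ t) P a) (fun τ h1 h2 => by
      refine (norm_mul_le _ _).trans ((mul_le_mul (hP τ t (hp.trans h1) (h2.trans hqt))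
        (hu τ h1 h2) (norm_nonneg _) (by positivity)).trans_eq ?_)
      rw [mul_mul_mul_comm, ← Real.exp_add]
      ring_nf)
  have hc : k * N / (α + γ) ≤ N / 6 := by
    rw [div_le_div_iff₀ hpos (by norm_num)]
    nlinarith
  refine h.trans (mul_le_mul hc ?_ ?_ (by positivity))
  · rw [show -α * (t - q) + γ * q + η = (α + γ) * q + (η - α * t) by ring]
    linarith [Real.exp_pos ((α + γ) * p + (η - α * t))]
  · rw [sub_nonneg, Real.exp_le_exp]
    nlinarith

theorem norm_unstable_sub_le (hρ : 0 < ρ) (hk0 : 0 ≤ k) (hkρ : 6 * k ≤ ρ)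
    (hD : ∀ c d a : R, ∀ t : ℝ, 0 ≤ t →
      HasDerivWithinAt (fun τ => c * (d * (Φinv τ * (Ψ τ * a))))
        (c * (d * (Φinv t * B t)) * (Ψ t * a)) (Ici 0) t)
    (hQ : ∀ t s : ℝ, 0 ≤ t → t ≤ s →
      ‖Φ t * (Q * (Φinv s * B s))‖ ≤ k * Real.exp (α * (t - s)))
    {a : R} {N γ η p q t : ℝ} (hN : 0 ≤ N) (hγ : ρ ≤ α - γ) (ht : 0 ≤ t) (htp : t ≤ p)
    (hpq : p ≤ q)
    (hu : ∀ τ, p ≤ τ → τ ≤ q → ‖Ψ τ * a‖ ≤ N * Real.exp (γ * τ + η)) :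
    ‖Φ t * (Q * (Φinv q * (Ψ q * a))) - Φ t * (Q * (Φinv p * (Ψ p * a)))‖ ≤
      N / 6 * Real.exp (α * (t - p) + γ * p + η) := by
  have hpos : 0 < α - γ := hρ.trans_le hγ
  have h := norm_sub_le_of_norm_deriv_le_exp (c := k * N) (r := -(α - γ)) (η := η + α * t)
    (ht.trans htp) hpq (neg_ne_zero.2 hpos.ne') (hD (Φ t) Q a) (fun τ h1 h2 => by
      refine (norm_mul_le _ _).trans ((mul_le_mul (hQ t τ ht (htp.trans h1))
        (hu τ h1 h2) (norm_nonneg _) (by positivity)).trans_eq ?_)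
      rw [mul_mul_mul_comm, ← Real.exp_add]
      ring_nf)
  have hc : k * N / (α - γ) ≤ N / 6 := by
    rw [div_le_div_iff₀ hpos (by norm_num)]
    nlinarith
  rw [div_neg, neg_mul, ← mul_neg, neg_sub] at h
  refine h.trans (mul_le_mul hc ?_ ?_ (by positivity))
  · rw [show α * (t - p) + γ * p + η = -(α - γ) * p + (η + α * t) by ring]
    linarith [Real.exp_pos (-(α - γ) * q + (η + α * t))]
  · rw [sub_nonneg, Real.exp_le_exp]
    nlinarith

variable {M ε β T s N : ℝ} {a b : R}

/-- One application of the Green operator of the unperturbed system to the pair formed by a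
solution `Ψ a` on `[s, T]` and a solution `Ψ b` on `[0, s]` improves its exponential bound. -/
theorem norm_green_improve (hβ : 0 ≤ β) (hβα : β < α) (hk0 : 0 ≤ k) (hkρ : 6 * k ≤ α - β)
    (hPQ : P + Q = 1)
    (hinv : ∀ t : ℝ, 0 ≤ t → Φ t * Φinv t = 1)
    (hD : ∀ c d a : R, ∀ t : ℝ, 0 ≤ t →
      HasDerivWithinAt (fun τ => c * (d * (Φinv τ * (Ψ τ * a))))
        (c * (d * (Φinv t * B t)) * (Ψ t * a)) (Ici 0) t)
    (hP : ∀ s t : ℝ, 0 ≤ s → s ≤ t →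
      ‖Φ t * (P * Φinv s)‖ ≤ M * Real.exp (-α * (t - s)) * Real.exp (ε * s))
    (hQ : ∀ t s : ℝ, 0 ≤ t → t ≤ s →
      ‖Φ t * (Q * Φinv s)‖ ≤ M * Real.exp (α * (t - s)) * Real.exp (ε * s))
    (hPB : ∀ s t : ℝ, 0 ≤ s → s ≤ t →
      ‖Φ t * (P * (Φinv s * B s))‖ ≤ k * Real.exp (-α * (t - s)))
    (hQB : ∀ t s : ℝ, 0 ≤ t → t ≤ s →
      ‖Φ t * (Q * (Φinv s * B s))‖ ≤ k * Real.exp (α * (t - s)))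
    (hM : 0 ≤ M) (hs : 0 ≤ s) (hsT : s ≤ T) (hN : 0 ≤ N)
    (ha : Q * (Φinv T * (Ψ T * a)) = 0) (hb : P * (Φinv 0 * (Ψ 0 * b)) = 0)
    (hua : ∀ t, s ≤ t → t ≤ T → ‖Ψ t * a‖ ≤ N * Real.exp (-β * (t - s)))
    (hub : ∀ t, 0 ≤ t → t ≤ s → ‖Ψ t * b‖ ≤ N * Real.exp (β * (t - s))) :
    (∀ t, s ≤ t → t ≤ T → ‖Ψ t * a‖ ≤
      (M * Real.exp (ε * s) * ‖Ψ s * (a + b)‖ + N / 2) * Real.exp (-β * (t - s))) ∧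
    (∀ t, 0 ≤ t → t ≤ s → ‖Ψ t * b‖ ≤
      (M * Real.exp (ε * s) * ‖Ψ s * (a + b)‖ + N / 2) * Real.exp (β * (t - s))) := by
  have hρ : 0 < α - β := sub_pos.2 hβα
  have hua' : ∀ t, s ≤ t → t ≤ T → ‖Ψ t * a‖ ≤ N * Real.exp (-β * t + β * s) :=
    fun t h1 h2 => (hua t h1 h2).trans_eq (by ring_nf)
  have hub' : ∀ t, 0 ≤ t → t ≤ s → ‖Ψ t * b‖ ≤ N * Real.exp (β * t + -β * s) :=
    fun t h1 h2 => (hub t h1 h2).trans_eq (by ring_nf)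
  have hsplit : ∀ (t : ℝ), 0 ≤ t → ∀ c : R,
      Ψ t * c = Φ t * (P * (Φinv t * (Ψ t * c))) + Φ t * (Q * (Φinv t * (Ψ t * c))) := by
    intro t ht c
    rw [← mul_add, ← add_mul, hPQ, one_mul, ← mul_assoc, hinv t ht, one_mul]
  constructor
  · intro t hst htT
    have ht := hs.trans hst
    have h1 := norm_stable_sub_le (γ := -β) hρ hk0 hkρ hD hPB hN (by linarith) hs hst le_rfl
      (fun τ h1 h2 => hua' τ h1 (h2.trans htT))
    have h2 := norm_stable_sub_le (γ := β) hρ hk0 hkρ hD hPB hN (by linarith) le_rfl hs hst hub'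
    have h3 := norm_unstable_sub_le (γ := -β) hρ hk0 hkρ hD hQB hN (by linarith) ht le_rfl htT
      (fun τ h1 h2 => hua' τ (hst.trans h1) h2)
    have h4 : ‖Φ t * (P * (Φinv s * (Ψ s * (a + b))))‖ ≤
        M * Real.exp (-α * (t - s)) * Real.exp (ε * s) * ‖Ψ s * (a + b)‖ := by
      rw [← mul_assoc P, ← mul_assoc (Φ t)]
      exact (norm_mul_le _ _).trans
        (mul_le_mul_of_nonneg_right (hP s t hs hst) (norm_nonneg _))
    have hle : Real.exp (-α * (t - s)) ≤ Real.exp (-β * (t - s)) :=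
      Real.exp_le_exp.2 (by nlinarith)
    rw [hb, mul_zero, sub_zero] at h2
    rw [ha, mul_zero, zero_sub, norm_neg] at h3
    rw [show -α * (t - t) + -β * t + β * s = -β * (t - s) by ring] at h1
    rw [show -α * (t - s) + β * s + -β * s = -α * (t - s) by ring] at h2
    rw [show α * (t - t) + -β * t + β * s = -β * (t - s) by ring] at h3
    have heq : Ψ t * a =
        (Φ t * (P * (Φinv t * (Ψ t * a))) - Φ t * (P * (Φinv s * (Ψ s * a)))) +
        (Φ t * (P * (Φinv s * (Ψ s * (a + b)))) - Φ t * (P * (Φinv s * (Ψ s * b)))) +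
        Φ t * (Q * (Φinv t * (Ψ t * a))) := by
      refine (hsplit t ht a).trans ?_
      simp only [mul_add]
      abel
    have hn : ‖Ψ t * a‖ ≤ _ := heq ▸ norm_add₃_le
    have hn' := norm_sub_le (Φ t * (P * (Φinv s * (Ψ s * (a + b)))))
      (Φ t * (P * (Φinv s * (Ψ s * b))))
    have hx : M * Real.exp (ε * s) * ‖Ψ s * (a + b)‖ * Real.exp (-α * (t - s)) ≤
        M * Real.exp (ε * s) * ‖Ψ s * (a + b)‖ * Real.exp (-β * (t - s)) :=
      mul_le_mul_of_nonneg_left hle (by positivity)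
    have hy := mul_le_mul_of_nonneg_left hle (by positivity : (0 : ℝ) ≤ N / 6)
    linarith
  · intro t ht hts
    have h1 := norm_unstable_sub_le (γ := β) hρ hk0 hkρ hD hQB hN le_rfl ht le_rfl hts
      (fun τ h1 h2 => hub' τ (ht.trans h1) h2)
    have h2 := norm_unstable_sub_le (γ := -β) hρ hk0 hkρ hD hQB hN (by linarith) ht hts hsT hua'
    have h3 := norm_stable_sub_le (γ := β) hρ hk0 hkρ hD hPB hN (by linarith) le_rfl ht le_rfl
      (fun τ h1 h2 => hub' τ h1 (h2.trans hts))
    have h4 : ‖Φ t * (Q * (Φinv s * (Ψ s * (a + b))))‖ ≤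
        M * Real.exp (α * (t - s)) * Real.exp (ε * s) * ‖Ψ s * (a + b)‖ := by
      rw [← mul_assoc Q, ← mul_assoc (Φ t)]
      exact (norm_mul_le _ _).trans
        (mul_le_mul_of_nonneg_right (hQ t s ht hts) (norm_nonneg _))
    have hle : Real.exp (α * (t - s)) ≤ Real.exp (β * (t - s)) :=
      Real.exp_le_exp.2 (by nlinarith)
    rw [ha, mul_zero, zero_sub, norm_neg] at h2
    rw [hb, mul_zero, sub_zero] at h3
    rw [norm_sub_rev, show α * (t - t) + β * t + -β * s = β * (t - s) by ring] at h1
    rw [show α * (t - s) + -β * s + β * s = α * (t - s) by ring] at h2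
    rw [show -α * (t - t) + β * t + -β * s = β * (t - s) by ring] at h3
    have heq : Ψ t * b =
        (Φ t * (Q * (Φinv t * (Ψ t * b))) - Φ t * (Q * (Φinv s * (Ψ s * b)))) +
        (Φ t * (Q * (Φinv s * (Ψ s * (a + b)))) - Φ t * (Q * (Φinv s * (Ψ s * a)))) +
        Φ t * (P * (Φinv t * (Ψ t * b))) := by
      refine (hsplit t ht b).trans ?_
      simp only [mul_add]
      abel
    have hn : ‖Ψ t * b‖ ≤ _ := heq ▸ norm_add₃_le
    have hn' := norm_sub_le (Φ t * (Q * (Φinv s * (Ψ s * (a + b)))))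
      (Φ t * (Q * (Φinv s * (Ψ s * a))))
    have hx : M * Real.exp (ε * s) * ‖Ψ s * (a + b)‖ * Real.exp (α * (t - s)) ≤
        M * Real.exp (ε * s) * ‖Ψ s * (a + b)‖ * Real.exp (β * (t - s)) :=
      mul_le_mul_of_nonneg_left hle (by positivity)
    have hy := mul_le_mul_of_nonneg_left hle (by positivity : (0 : ℝ) ≤ N / 6)
    linarith

theorem norm_green_le (hβ : 0 ≤ β) (hβα : β < α) (hk0 : 0 ≤ k) (hkρ : 6 * k ≤ α - β)
    (hPQ : P + Q = 1)
    (hinv : ∀ t : ℝ, 0 ≤ t → Φ t * Φinv t = 1)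
    (hΨ : ContinuousOn Ψ (Ici 0))
    (hD : ∀ c d a : R, ∀ t : ℝ, 0 ≤ t →
      HasDerivWithinAt (fun τ => c * (d * (Φinv τ * (Ψ τ * a))))
        (c * (d * (Φinv t * B t)) * (Ψ t * a)) (Ici 0) t)
    (hP : ∀ s t : ℝ, 0 ≤ s → s ≤ t →
      ‖Φ t * (P * Φinv s)‖ ≤ M * Real.exp (-α * (t - s)) * Real.exp (ε * s))
    (hQ : ∀ t s : ℝ, 0 ≤ t → t ≤ s →
      ‖Φ t * (Q * Φinv s)‖ ≤ M * Real.exp (α * (t - s)) * Real.exp (ε * s))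
    (hPB : ∀ s t : ℝ, 0 ≤ s → s ≤ t →
      ‖Φ t * (P * (Φinv s * B s))‖ ≤ k * Real.exp (-α * (t - s)))
    (hQB : ∀ t s : ℝ, 0 ≤ t → t ≤ s →
      ‖Φ t * (Q * (Φinv s * B s))‖ ≤ k * Real.exp (α * (t - s)))
    (hM : 0 ≤ M) (hs : 0 ≤ s) (hsT : s ≤ T)
    (ha : Q * (Φinv T * (Ψ T * a)) = 0) (hb : P * (Φinv 0 * (Ψ 0 * b)) = 0) :
    (∀ t, s ≤ t → t ≤ T → ‖Ψ t * a‖ ≤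
      2 * M * Real.exp (ε * s) * ‖Ψ s * (a + b)‖ * Real.exp (-β * (t - s))) ∧
    (∀ t, 0 ≤ t → t ≤ s → ‖Ψ t * b‖ ≤
      2 * M * Real.exp (ε * s) * ‖Ψ s * (a + b)‖ * Real.exp (β * (t - s))) := by
  have hcont : ∀ (c : R) (r : ℝ), ContinuousOn (fun t => ‖Ψ t * c‖ * Real.exp (r * (t - s)))
      (Ici 0) := fun c r => (hΨ.mul continuousOn_const).norm.mul (by fun_prop)
  obtain ⟨t₁, ht₁, hmax₁⟩ := isCompact_Icc.exists_isMaxOn (nonempty_Icc.2 hsT)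
    ((hcont a β).mono (fun x hx => hs.trans hx.1))
  obtain ⟨t₂, ht₂, hmax₂⟩ := isCompact_Icc.exists_isMaxOn (nonempty_Icc.2 hs)
    ((hcont b (-β)).mono (fun x hx => hx.1))
  have hcancel : ∀ r x y : ℝ, x * Real.exp (-r * y) * Real.exp (r * y) = x := fun r x y => by
    rw [mul_assoc, ← Real.exp_add, neg_mul, neg_add_cancel, Real.exp_zero, mul_one]
  have hcancel' : ∀ r x y : ℝ, x * Real.exp (r * y) * Real.exp (-r * y) = x := fun r x y => by
    rw [mul_right_comm, hcancel]
  set N := max (‖Ψ t₁ * a‖ * Real.exp (β * (t₁ - s))) (‖Ψ t₂ * b‖ * Real.exp (-β * (t₂ - s)))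
    with hNdef
  have hN : 0 ≤ N := le_max_of_le_left (by positivity)
  have hua : ∀ t, s ≤ t → t ≤ T → ‖Ψ t * a‖ ≤ N * Real.exp (-β * (t - s)) := by
    intro t h1 h2
    have h : ‖Ψ t * a‖ * Real.exp (β * (t - s)) ≤ N :=
      (hmax₁ (⟨h1, h2⟩ : t ∈ Icc s T)).trans (le_max_left _ _)
    rw [← hcancel' β ‖Ψ t * a‖ (t - s)]
    exact mul_le_mul_of_nonneg_right h (Real.exp_pos _).le
  have hub : ∀ t, 0 ≤ t → t ≤ s → ‖Ψ t * b‖ ≤ N * Real.exp (β * (t - s)) := by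
    intro t h1 h2
    have h : ‖Ψ t * b‖ * Real.exp (-β * (t - s)) ≤ N :=
      (hmax₂ (⟨h1, h2⟩ : t ∈ Icc 0 s)).trans (le_max_right _ _)
    rw [← hcancel β ‖Ψ t * b‖ (t - s)]
    exact mul_le_mul_of_nonneg_right h (Real.exp_pos _).le
  obtain ⟨ia, ib⟩ := norm_green_improve hβ hβα hk0 hkρ hPQ hinv hD hP hQ hPB hQB hM hs hsT hN
    ha hb hua hub
  have hN' : N ≤ M * Real.exp (ε * s) * ‖Ψ s * (a + b)‖ + N / 2 := by
    refine max_le ?_ ?_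
    · have h := mul_le_mul_of_nonneg_right (ia t₁ ht₁.1 ht₁.2)
        (Real.exp_pos (β * (t₁ - s))).le
      rwa [hcancel] at h
    · have h := mul_le_mul_of_nonneg_right (ib t₂ ht₂.1 ht₂.2)
        (Real.exp_pos (-β * (t₂ - s))).le
      rwa [hcancel'] at h
  have hN2 : N ≤ 2 * M * Real.exp (ε * s) * ‖Ψ s * (a + b)‖ := by linarith
  exact ⟨fun t h1 h2 => (hua t h1 h2).trans
      (mul_le_mul_of_nonneg_right hN2 (Real.exp_pos _).le),
    fun t h1 h2 => (hub t h1 h2).trans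
      (mul_le_mul_of_nonneg_right hN2 (Real.exp_pos _).le)⟩

end Green

/-- A left-regular element of a finite-dimensional algebra has a two-sided inverse. -/
theorem exists_inverse_of_mul_eq_zero [FiniteDimensional ℝ R] {L : R}
    (h : ∀ v, L * v = 0 → v = 0) : ∃ K, L * K = 1 ∧ K * L = 1 := by
  have hinj : Function.Injective (LinearMap.mulLeft ℝ L) :=
    (injective_iff_map_eq_zero _).2 h
  obtain ⟨K, hK⟩ := LinearMap.injective_iff_surjective.1 hinj 1
  have hK : L * K = 1 := hK
  refine ⟨K, hK, sub_eq_zero.1 (h _ ?_)⟩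
  rw [mul_sub, ← mul_assoc, hK, one_mul, mul_one, sub_self]

/-- Roughness on a compact interval `[0, T]`, with constants independent of `T`. -/
theorem exists_projection_on_Icc [FiniteDimensional ℝ R] {B Φ Φinv Ψ Ψinv : ℝ → R} {P : R}
    {α β ε k M T : ℝ} (hβ : 0 ≤ β) (hβα : β < α) (hk0 : 0 ≤ k) (hkρ : 6 * k ≤ α - β)
    (hPP : P * P = P)
    (hinv : ∀ t : ℝ, 0 ≤ t → Φ t * Φinv t = 1)
    (hΨ : ContinuousOn Ψ (Ici 0))
    (hΨinv : ∀ t : ℝ, 0 ≤ t → Ψ t * Ψinv t = 1 ∧ Ψinv t * Ψ t = 1)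
    (hD : ∀ c d a : R, ∀ t : ℝ, 0 ≤ t →
      HasDerivWithinAt (fun τ => c * (d * (Φinv τ * (Ψ τ * a))))
        (c * (d * (Φinv t * B t)) * (Ψ t * a)) (Ici 0) t)
    (hP : ∀ s t : ℝ, 0 ≤ s → s ≤ t →
      ‖Φ t * (P * Φinv s)‖ ≤ M * Real.exp (-α * (t - s)) * Real.exp (ε * s))
    (hQ : ∀ t s : ℝ, 0 ≤ t → t ≤ s →
      ‖Φ t * ((1 - P) * Φinv s)‖ ≤ M * Real.exp (α * (t - s)) * Real.exp (ε * s))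
    (hPB : ∀ s t : ℝ, 0 ≤ s → s ≤ t →
      ‖Φ t * (P * (Φinv s * B s))‖ ≤ k * Real.exp (-α * (t - s)))
    (hQB : ∀ t s : ℝ, 0 ≤ t → t ≤ s →
      ‖Φ t * ((1 - P) * (Φinv s * B s))‖ ≤ k * Real.exp (α * (t - s)))
    (hM : 0 ≤ M) (hT : 0 ≤ T) :
    ∃ S : R, S * S = S ∧
      (∀ s t : ℝ, 0 ≤ s → s ≤ t → t ≤ T → ‖Ψ t * (S * Ψinv s)‖ ≤
        2 * M * ‖(1 : R)‖ * Real.exp (-β * (t - s)) * Real.exp (ε * s)) ∧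
      (∀ t s : ℝ, 0 ≤ t → t ≤ s → s ≤ T → ‖Ψ t * ((1 - S) * Ψinv s)‖ ≤
        2 * M * ‖(1 : R)‖ * Real.exp (β * (t - s)) * Real.exp (ε * s)) := by
  have hPQ : P + (1 - P) = 1 := by abel
  have hPQ0 : P * (1 - P) = 0 := by rw [mul_sub, mul_one, hPP, sub_self]
  have hQP0 : (1 - P) * P = 0 := by rw [sub_mul, one_mul, hPP, sub_self]
  have hQQ : (1 - P) * (1 - P) = 1 - P := by rw [mul_sub, mul_one, hQP0, sub_zero]
  set L := P * (Φinv 0 * Ψ 0) + (1 - P) * (Φinv T * Ψ T) with hL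
  have hPL : P * L = P * (Φinv 0 * Ψ 0) := by
    rw [hL, mul_add, ← mul_assoc P P, ← mul_assoc P (1 - P), hPP, hPQ0, zero_mul, add_zero]
  have hQL : (1 - P) * L = (1 - P) * (Φinv T * Ψ T) := by
    rw [hL, mul_add, ← mul_assoc (1 - P) P, ← mul_assoc (1 - P) (1 - P), hQQ, hQP0, zero_mul,
      zero_add]
  have hLinj : ∀ v, L * v = 0 → v = 0 := by
    intro v hv
    have hPv : P * (Φinv 0 * (Ψ 0 * -v)) = 0 := by
      have : P * L * v = 0 := by rw [mul_assoc, hv, mul_zero]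
      rw [hPL, mul_assoc, mul_assoc] at this
      rw [mul_neg, mul_neg, mul_neg, this, neg_zero]
    have hQv : (1 - P) * (Φinv T * (Ψ T * v)) = 0 := by
      have : (1 - P) * L * v = 0 := by rw [mul_assoc, hv, mul_zero]
      rwa [hQL, mul_assoc, mul_assoc] at this
    have h := (norm_green_le hβ hβα hk0 hkρ hPQ hinv hΨ hD hP hQ hPB hQB hM le_rfl hT
      hQv hPv).1 0 le_rfl hT
    rw [add_neg_cancel, mul_zero (Ψ 0), norm_zero, mul_zero, zero_mul, norm_le_zero_iff] at h
    rw [← one_mul v, ← (hΨinv 0 le_rfl).2, mul_assoc, h, mul_zero]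
  obtain ⟨K, hLK, hKL⟩ := exists_inverse_of_mul_eq_zero hLinj
  set S := K * (P * L) with hS
  have hLS : L * S = P * L := by rw [hS, ← mul_assoc, hLK, one_mul]
  have hPD : P * (Φinv 0 * (Ψ 0 * (1 - S))) = 0 := by
    rw [← mul_assoc (Φinv 0), ← mul_assoc P, ← hPL, mul_assoc, mul_sub, mul_one, hLS, mul_sub,
      ← mul_assoc P P, hPP, sub_self]
  have hQD : (1 - P) * (Φinv T * (Ψ T * S)) = 0 := by
    rw [← mul_assoc (Φinv T), ← mul_assoc (1 - P), ← hQL, mul_assoc, hLS,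
      ← mul_assoc (1 - P) P, hQP0, zero_mul]
  have hsum : ∀ s, 0 ≤ s → Ψ s * (S * Ψinv s + (1 - S) * Ψinv s) = 1 := fun s hs => by
    rw [← add_mul, add_sub_cancel, one_mul, (hΨinv s hs).1]
  have hgreen : ∀ s, 0 ≤ s → s ≤ T → _ := fun s hs hsT =>
    norm_green_le (a := S * Ψinv s) (b := (1 - S) * Ψinv s)
      hβ hβα hk0 hkρ hPQ hinv hΨ hD hP hQ hPB hQB hM hs hsT
      (by rw [← mul_assoc (Ψ T), ← mul_assoc (Φinv T), ← mul_assoc (1 - P), hQD, zero_mul])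
      (by rw [← mul_assoc (Ψ 0), ← mul_assoc (Φinv 0), ← mul_assoc P, hPD, zero_mul])
  refine ⟨S, ?_, ?_, ?_⟩
  · calc S * S = K * (P * (L * S)) := by simp only [hS, mul_assoc]
      _ = S := by rw [hLS, ← mul_assoc P P, hPP]
  · intro s t hs hst htT
    have h := (hgreen s hs (hst.trans htT)).1 t hst htT
    rw [hsum s hs] at h
    linarith
  · intro t s ht hts hsT
    have h := (hgreen s (ht.trans hts) hsT).2 t ht hts
    rw [hsum s (ht.trans hts)] at h
    linarith

/-- Roughness on `[0, ∞)`, as a limit of the projections on `[0, T]`. -/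
theorem exists_projection_on_Ici [FiniteDimensional ℝ R] {Ψ Ψinv : ℝ → R} {C β ε : ℝ}
    (hΨinv : Ψ 0 * Ψinv 0 = 1 ∧ Ψinv 0 * Ψ 0 = 1)
    (h : ∀ T : ℝ, 0 ≤ T → ∃ S : R, S * S = S ∧
      (∀ s t : ℝ, 0 ≤ s → s ≤ t → t ≤ T → ‖Ψ t * (S * Ψinv s)‖ ≤
        C * Real.exp (-β * (t - s)) * Real.exp (ε * s)) ∧
      (∀ t s : ℝ, 0 ≤ t → t ≤ s → s ≤ T → ‖Ψ t * ((1 - S) * Ψinv s)‖ ≤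
        C * Real.exp (β * (t - s)) * Real.exp (ε * s))) :
    ∃ S : R, S * S = S ∧
      (∀ s t : ℝ, 0 ≤ s → s ≤ t → ‖Ψ t * (S * Ψinv s)‖ ≤
        C * Real.exp (-β * (t - s)) * Real.exp (ε * s)) ∧
      (∀ t s : ℝ, 0 ≤ t → t ≤ s → ‖Ψ t * ((1 - S) * Ψinv s)‖ ≤
        C * Real.exp (β * (t - s)) * Real.exp (ε * s)) := by
  choose p hpp hps hpu using fun m : ℕ => h m m.cast_nonneg
  have : ProperSpace R := FiniteDimensional.proper ℝ R
  have hbdd : ∀ m, p m ∈ Metric.closedBall (0 : R) (‖Ψinv 0‖ * (C * ‖Ψ 0‖)) := by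
    intro m
    have h0 := hps m 0 0 le_rfl le_rfl m.cast_nonneg
    simp only [sub_self, mul_zero, Real.exp_zero, mul_one] at h0
    have heq : p m = Ψinv 0 * (Ψ 0 * (p m * Ψinv 0) * Ψ 0) := by
      rw [mul_assoc, mul_assoc, hΨinv.2, mul_one, ← mul_assoc, hΨinv.2, one_mul]
    rw [mem_closedBall_zero_iff, heq]
    refine (norm_mul_le _ _).trans (mul_le_mul_of_nonneg_left ?_ (norm_nonneg _))
    exact (norm_mul_le _ _).trans (mul_le_mul_of_nonneg_right h0 (norm_nonneg _))
  obtain ⟨S, -, φ, hφ, hlim⟩ := tendsto_subseq_of_bounded Metric.isBounded_closedBall hbdd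
  have hev : ∀ x : ℝ, ∀ᶠ m in atTop, x ≤ (φ m : ℝ) := fun x =>
    (tendsto_natCast_atTop_atTop.comp hφ.tendsto_atTop).eventually_ge_atTop x
  refine ⟨S, ?_, ?_, ?_⟩
  · refine tendsto_nhds_unique (hlim.mul hlim) (hlim.congr fun m => (hpp (φ m)).symm)
  · intro s t hs hst
    refine le_of_tendsto ((hlim.mul_const (Ψinv s)).const_mul (Ψ t)).norm ?_
    filter_upwards [hev t] with m hm using hps (φ m) s t hs hst hm
  · intro t s ht hts
    refine le_of_tendsto (((hlim.const_sub 1).mul_const (Ψinv s)).const_mul (Ψ t)).norm ?_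
    filter_upwards [hev s] with m hm using hpu (φ m) t s ht hts hm

end NormedRing


/-- roughness of nonuniform exponential dichotomy; Proposition 3.2(2a).
For all constants `M > 0`, `α > 0`, `ε ∈ [0, α)` there exists `δ₀ > 0`, depending only on
`M`, `α` and `ε`, such that: whenever `x' = A(t) x` (with `A` continuous) has a fundamental
matrix `Φ` admitting a nonuniform exponential dichotomy with projection `P` and constants
`M, α, ε`, then for every `δ ∈ (0, δ₀]` and every continuous `B` with
`‖B(t)‖ ≤ δ e^{-ε t}` for all `t ≥ 0`, every fundamental matrix `Ψ` of the perturbed system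
`x' = (A(t) + B(t)) x` admits a nonuniform exponential dichotomy. -/
theorem nonuniform_exponential_dichotomy_roughness
    (M α ε : ℝ) (hM : 0 < M) (hα : 0 < α) (hε0 : 0 ≤ ε) (hεα : ε < α) :
    ∃ δ₀ > (0 : ℝ), ∀ (n : ℕ)
      (A Φ Φinv : ℝ → EuclideanSpace ℝ (Fin n) →L[ℝ] EuclideanSpace ℝ (Fin n)),
      Continuous A →
      (∀ t : ℝ, 0 ≤ t → HasDerivAt Φ (A t ∘L Φ t) t) →
      (∀ t : ℝ, 0 ≤ t → Φ t ∘L Φinv t = 1 ∧ Φinv t ∘L Φ t = 1) →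
      ∀ P : EuclideanSpace ℝ (Fin n) →L[ℝ] EuclideanSpace ℝ (Fin n), P ∘L P = P →
      (∀ s t : ℝ, 0 ≤ s → s ≤ t →
        ‖Φ t ∘L P ∘L Φinv s‖ ≤ M * Real.exp (-α * (t - s)) * Real.exp (ε * s)) →
      (∀ t s : ℝ, 0 ≤ t → t ≤ s →
        ‖Φ t ∘L (1 - P) ∘L Φinv s‖ ≤ M * Real.exp (α * (t - s)) * Real.exp (ε * s)) →
      ∀ δ : ℝ, 0 < δ → δ ≤ δ₀ →
      ∀ B : ℝ → EuclideanSpace ℝ (Fin n) →L[ℝ] EuclideanSpace ℝ (Fin n),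
        Continuous B → (∀ t : ℝ, 0 ≤ t → ‖B t‖ ≤ δ * Real.exp (-ε * t)) →
      ∀ Ψ Ψinv : ℝ → EuclideanSpace ℝ (Fin n) →L[ℝ] EuclideanSpace ℝ (Fin n),
        (∀ t : ℝ, 0 ≤ t → HasDerivAt Ψ ((A t + B t) ∘L Ψ t) t) →
        (∀ t : ℝ, 0 ≤ t → Ψ t ∘L Ψinv t = 1 ∧ Ψinv t ∘L Ψ t = 1) →
      ∃ Ptilde : EuclideanSpace ℝ (Fin n) →L[ℝ] EuclideanSpace ℝ (Fin n),
        Ptilde ∘L Ptilde = Ptilde ∧ ∃ Mtilde > (0 : ℝ), ∃ αtilde > (0 : ℝ),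
          ∃ εtilde : ℝ, 0 ≤ εtilde ∧ εtilde < αtilde ∧
          (∀ s t : ℝ, 0 ≤ s → s ≤ t →
            ‖Ψ t ∘L Ptilde ∘L Ψinv s‖ ≤
              Mtilde * Real.exp (-αtilde * (t - s)) * Real.exp (εtilde * s)) ∧
          (∀ t s : ℝ, 0 ≤ t → t ≤ s →
            ‖Ψ t ∘L (1 - Ptilde) ∘L Ψinv s‖ ≤
              Mtilde * Real.exp (αtilde * (t - s)) * Real.exp (εtilde * s)) := by
  refine ⟨(α - ε) / (12 * M), div_pos (sub_pos.2 hεα) (by positivity), ?_⟩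
  intro n A Φ Φinv _ hΦ hinv P hPP hP hQ δ hδ hδ₀ B _ hB Ψ Ψinv hΨ hΨinv
  have hΨcont : ContinuousOn Ψ (Ici 0) := fun t ht =>
    (hΨ t ht).continuousAt.continuousWithinAt
  have hD := fun c d a t => hasDerivWithinAt_transition (t := t) hΦ hinv hΨ c d a
  have hkernel : ∀ (X : EuclideanSpace ℝ (Fin n) →L[ℝ] EuclideanSpace ℝ (Fin n)) (s t r : ℝ),
      0 ≤ s → ‖Φ t * (X * Φinv s)‖ ≤ M * Real.exp r * Real.exp (ε * s) →
      ‖Φ t * (X * (Φinv s * B s))‖ ≤ M * δ * Real.exp r := by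
    intro X s t r hs hX
    rw [← mul_assoc X, ← mul_assoc (Φ t)]
    refine (norm_mul_le _ _).trans ((mul_le_mul hX (hB s hs) (norm_nonneg _)
      (by positivity)).trans_eq ?_)
    have : Real.exp (ε * s) * Real.exp (-ε * s) = 1 := by
      rw [← Real.exp_add, neg_mul, add_neg_cancel, Real.exp_zero]
    linear_combination (M * Real.exp r * δ) * this
  have hk : 6 * (M * δ) ≤ α - (α + ε) / 2 := by
    rw [le_div_iff₀ (by positivity)] at hδ₀
    linarith
  obtain ⟨S, hS, hs, hu⟩ := exists_projection_on_Ici (hΨinv 0 le_rfl) fun T hT =>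
    exists_projection_on_Icc (β := (α + ε) / 2) (by positivity) (by linarith) (by positivity) hk
      hPP (fun t ht => (hinv t ht).1) hΨcont hΨinv hD hP hQ
      (fun s t h0 hst => hkernel P s t _ h0 (hP s t h0 hst))
      (fun t s h0 hts => hkernel (1 - P) s t _ (h0.trans hts) (hQ t s h0 hts)) hM.le hT
  have hC : 2 * M * ‖(1 : EuclideanSpace ℝ (Fin n) →L[ℝ] EuclideanSpace ℝ (Fin n))‖ ≤
      2 * M := mul_le_of_le_one_right (by positivity) ContinuousLinearMap.norm_id_le
  refine ⟨S, hS, 2 * M, by positivity, (α + ε) / 2, by positivity, ε, hε0, by linarith,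
    fun s t h0 hst => (hs s t h0 hst).trans ?_, fun t s h0 hts => (hu t s h0 hts).trans ?_⟩ <;>
  gcongr
end

section
/- The exponential dichotomy spectrum of the scalar equation x' = (t sin t)x is all of ℝ. Precisely, for f(τ) = τ sin τ and for every γ ∈ ℝ, M > 0 and α > 0: (a) there exist 0 ≤ s ≤ t (for instance s = 2kπ, t = (2k+1)π with k large) such that exp(∫_s^t f(τ) dτ − γ(t−s)) > M e^{−α(t−s)}; and (b) there exist 0 ≤ t ≤ s (for instance t = (2k+1)π, s = (2k+2)π with k large) such that exp(∫_s^t f(τ) dτ − γ(t−s)) > M e^{α(t−s)}. Hence for no γ ∈ ℝ does the shifted equation y' = (t sin t − γ)y admit an exponential dichotomy. -/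
theorem integral_id_mul_sin (a b : ℝ) :
    ∫ τ in a..b, τ * Real.sin τ =
      (Real.sin b - b * Real.cos b) - (Real.sin a - a * Real.cos a) := by
  refine intervalIntegral.integral_eq_sub_of_hasDerivAt
    (f := fun τ => Real.sin τ - τ * Real.cos τ) (fun τ _ => ?_)
    (Continuous.intervalIntegrable (by fun_prop) _ _)
  refine ((Real.hasDerivAt_sin τ).sub ((hasDerivAt_id τ).mul (Real.hasDerivAt_cos τ))).congr_deriv ?_
  simp only [id_eq]
  ring

theorem integral_id_mul_sin_nat_mul_pi (n : ℕ) :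
    ∫ τ in (n * Real.pi)..((n + 1) * Real.pi), τ * Real.sin τ =
      (-1) ^ n * ((2 * n + 1) * Real.pi) := by
  have hs := Real.sin_nat_mul_pi (n + 1)
  have hc := Real.cos_nat_mul_pi (n + 1)
  push_cast at hs hc
  rw [integral_id_mul_sin, hs, hc, Real.sin_nat_mul_pi, Real.cos_nat_mul_pi]
  ring

theorem mul_exp_lt_exp_of_add_le {M c d : ℝ} (h : M + c ≤ d) :
    M * Real.exp c < Real.exp d :=
  calc M * Real.exp c < Real.exp M * Real.exp c :=
        mul_lt_mul_of_pos_right (by linarith [Real.add_one_le_exp M]) (Real.exp_pos c)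
    _ = Real.exp (M + c) := (Real.exp_add M c).symm
    _ ≤ Real.exp d := Real.exp_le_exp.mpr h

theorem exists_forward_growth (γ M α : ℝ) :
    ∃ s t : ℝ, 0 ≤ s ∧ s ≤ t ∧
      M * Real.exp (-α * (t - s)) <
        Real.exp ((∫ τ in s..t, τ * Real.sin τ) - γ * (t - s)) := by
  obtain ⟨k, hk⟩ := exists_nat_ge (M - α * Real.pi + γ * Real.pi)
  have hπ := Real.pi_gt_three
  have hk0 : (0 : ℝ) ≤ k := k.cast_nonneg
  refine ⟨(2 * k : ℕ) * Real.pi, ((2 * k : ℕ) + 1) * Real.pi, by positivity, by linarith, ?_⟩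
  rw [integral_id_mul_sin_nat_mul_pi, pow_mul]
  apply mul_exp_lt_exp_of_add_le
  push_cast
  norm_num
  nlinarith

theorem exists_backward_growth (γ M α : ℝ) :
    ∃ t s : ℝ, 0 ≤ t ∧ t ≤ s ∧
      M * Real.exp (α * (t - s)) <
        Real.exp ((∫ τ in s..t, τ * Real.sin τ) - γ * (t - s)) := by
  obtain ⟨k, hk⟩ := exists_nat_ge (M - α * Real.pi - γ * Real.pi)
  have hπ := Real.pi_gt_three
  have hk0 : (0 : ℝ) ≤ k := k.cast_nonneg
  refine ⟨(2 * k + 1 : ℕ) * Real.pi, ((2 * k + 1 : ℕ) + 1) * Real.pi, by positivity,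
    by linarith, ?_⟩
  rw [intervalIntegral.integral_symm, integral_id_mul_sin_nat_mul_pi, pow_succ, pow_mul]
  apply mul_exp_lt_exp_of_add_le
  push_cast
  norm_num
  nlinarith

/-- The exponential dichotomy spectrum of the scalar equation
`x' = (t sin t) x` is all of `ℝ`. Precisely, for `f(τ) = τ sin τ` and for every `γ ∈ ℝ`,
`M > 0`, `α > 0`:
(a) there exist `0 ≤ s ≤ t` with `exp(∫_s^t f - γ(t-s)) > M e^{-α(t-s)}`;
(b) there exist `0 ≤ t ≤ s` with `exp(∫_s^t f - γ(t-s)) > M e^{α(t-s)}`.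
Hence for no `γ ∈ ℝ` does the shifted equation `y' = (t sin t - γ) y` admit an exponential
dichotomy. -/
theorem t_sin_t_dichotomy_spectrum_is_all_reals :
    (∀ γ M α : ℝ, 0 < M → 0 < α →
      (∃ s t : ℝ, 0 ≤ s ∧ s ≤ t ∧
        M * Real.exp (-α * (t - s)) <
          Real.exp ((∫ τ in s..t, τ * Real.sin τ) - γ * (t - s))) ∧
      (∃ t s : ℝ, 0 ≤ t ∧ t ≤ s ∧
        M * Real.exp (α * (t - s)) <
          Real.exp ((∫ τ in s..t, τ * Real.sin τ) - γ * (t - s)))) ∧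
    (∀ γ : ℝ, ¬ ∃ M > (0 : ℝ), ∃ α > (0 : ℝ),
      (∀ s t : ℝ, 0 ≤ s → s ≤ t →
        Real.exp ((∫ τ in s..t, τ * Real.sin τ) - γ * (t - s)) ≤
          M * Real.exp (-α * (t - s))) ∨
      (∀ t s : ℝ, 0 ≤ t → t ≤ s →
        Real.exp ((∫ τ in s..t, τ * Real.sin τ) - γ * (t - s)) ≤
          M * Real.exp (α * (t - s)))) := by
  refine ⟨fun γ M α _ _ => ⟨exists_forward_growth γ M α, exists_backward_growth γ M α⟩, ?_⟩
  rintro γ ⟨M, -, α, -, h | h⟩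
  · obtain ⟨s, t, hs, hst, hlt⟩ := exists_forward_growth γ M α
    exact (h s t hs hst).not_gt hlt
  · obtain ⟨t, s, ht, hts, hlt⟩ := exists_backward_growth γ M α
    exact (h t s ht hts).not_gt hlt
end
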